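/- Let α ∈ (0,1), σ = 1 − α/2, τ > 0, j ≥ 0 an integer, and let λ : [0, (j+σ)τ] → ℝ be positive and nonincreasing. Then for any real numbers v_0, v_1, …, v_{j+1}, one has (σ v_{j+1} + (1−σ) v_j) · Δ_{0t_{j+σ}}^{α,λ} v ≥ (1/2) Δ_{0t_{j+σ}}^{α,λ} (v²), where Δ_{0t_{j+σ}}^{α,λ} v = (τ^{1−α}/Γ(2−α)) Σ_{s=0}^{j} c_{j−s}^{(α)} (v_{s+1} − v_s)/τ and Δ_{0t_{j+σ}}^{α,λ}(v²) = (τ^{1−α}/Γ(2−α)) Σ_{s=0}^{j} c_{j−s}^{(α)} (v_{s+1}² − v_s²)/τ. -/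

import Mathlib

/-- `a_l^{(α)}`: `a_0 = σ^{1−α}`, `a_l = (l+σ)^{1−α} − (l−1+σ)^{1−α}` for `l ≥ 1`. -/
noncomputable def aCoef (α σ : ℝ) (l : ℕ) : ℝ :=
  if l = 0 then σ ^ (1 - α)
  else ((l : ℝ) + σ) ^ (1 - α) - ((l : ℝ) - 1 + σ) ^ (1 - α)

/-- `b_l^{(α)} = ((l+σ)^{2−α} − (l−1+σ)^{2−α})/(2−α) − ((l+σ)^{1−α} + (l−1+σ)^{1−α})/2` for `l ≥ 1`. -/
noncomputable def bCoef (α σ : ℝ) (l : ℕ) : ℝ :=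
  (((l : ℝ) + σ) ^ (2 - α) - ((l : ℝ) - 1 + σ) ^ (2 - α)) / (2 - α) -
    (((l : ℝ) + σ) ^ (1 - α) + ((l : ℝ) - 1 + σ) ^ (1 - α)) / 2

/-- `c_s^{(α)}` for the `_λ`L2-1`_σ` formula at the level `j`, with weight `λ` sampled at
multiples of the time step `τ` (`λ_r = λ(rτ)`):
if `j = 0`, `c_0 = λ_{σ−1/2} a_0`; if `j ≥ 1`, `c_0 = λ_{σ−1/2} a_0 + λ_σ b_1`,
`c_s = λ_{s+σ−1/2} a_s + λ_{s+σ} b_{s+1} − λ_{s+σ} b_s` for `1 ≤ s ≤ j−1`, and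
`c_j = λ_{j+σ−1/2} a_j − λ_{j+σ} b_j`. -/
noncomputable def cCoef (α σ τ : ℝ) (lam : ℝ → ℝ) (j s : ℕ) : ℝ :=
  if j = 0 then lam ((σ - 1 / 2) * τ) * aCoef α σ 0
  else if s = 0 then lam ((σ - 1 / 2) * τ) * aCoef α σ 0 + lam (σ * τ) * bCoef α σ 1
  else if s = j then
    lam (((j : ℝ) + σ - 1 / 2) * τ) * aCoef α σ j - lam (((j : ℝ) + σ) * τ) * bCoef α σ j
  else
    lam (((s : ℝ) + σ - 1 / 2) * τ) * aCoef α σ s + lam (((s : ℝ) + σ) * τ) * bCoef α σ (s + 1) -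
      lam (((s : ℝ) + σ) * τ) * bCoef α σ s

open Set

/-- One half of the Hermite–Hadamard inequality on a unit interval, for a convex derivative. -/
lemma sub_le_average_of_convexOn_deriv {f f' : ℝ → ℝ} {a : ℝ}
    (hf : ∀ x ∈ Icc a (a + 1), HasDerivAt f (f' x) x) (hc : ConvexOn ℝ (Icc a (a + 1)) f') :
    f (a + 1) - f a ≤ (f' a + f' (a + 1)) / 2 := by
  let g : ℝ → ℝ := fun t => f (a + t) - t * f' a - t ^ 2 / 2 * (f' (a + 1) - f' a)
  have hg : ∀ t ∈ Icc (0 : ℝ) 1,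
      HasDerivAt g (f' (a + t) - f' a - t * (f' (a + 1) - f' a)) t := by
    intro t ht
    have h1 := (hf (a + t) ⟨by linarith [ht.1], by linarith [ht.2]⟩).comp_const_add a t
    have h2 := (hasDerivAt_id t).mul_const (f' a)
    have h3 := (((hasDerivAt_id t).pow 2).div_const 2).mul_const (f' (a + 1) - f' a)
    refine ((h1.sub h2).sub h3).congr_deriv ?_
    simp
  have hanti : AntitoneOn g (Icc 0 1) := by
    refine antitoneOn_of_hasDerivWithinAt_nonpos (convex_Icc 0 1)
      (f' := fun t => f' (a + t) - f' a - t * (f' (a + 1) - f' a))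
      (fun t ht => (hg t ht).continuousAt.continuousWithinAt)
      (fun t ht => (hg t (interior_subset ht)).hasDerivWithinAt) ?_
    intro t ht
    replace ht := interior_subset ht
    have h := hc.2 (left_mem_Icc.2 (by linarith)) (right_mem_Icc.2 (by linarith))
      (sub_nonneg.2 ht.2) ht.1 (sub_add_cancel 1 t)
    simp only [smul_eq_mul] at h
    rw [show (1 - t) * a + t * (a + 1) = a + t by ring] at h
    linarith
  have h01 := hanti (left_mem_Icc.2 zero_le_one) (right_mem_Icc.2 zero_le_one) zero_le_one
  simp only [g, add_zero] at h01
  linarith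

/-- Mean value bounds on a unit interval, for an antitone derivative. -/
lemma sub_mem_Icc_of_antitoneOn_deriv {f f' : ℝ → ℝ} {a : ℝ}
    (hf : ∀ x ∈ Icc a (a + 1), HasDerivAt f (f' x) x) (hm : AntitoneOn f' (Icc a (a + 1))) :
    f (a + 1) - f a ∈ Icc (f' (a + 1)) (f' a) := by
  obtain ⟨c, hc, h⟩ := exists_hasDerivAt_eq_slope f f' (lt_add_one a)
    (fun x hx => (hf x hx).continuousAt.continuousWithinAt)
    (fun x hx => hf x (Ioo_subset_Icc_self hx))
  rw [add_sub_cancel_left, div_one] at h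
  rw [← h]
  exact ⟨hm (Ioo_subset_Icc_self hc) (right_mem_Icc.2 (by linarith)) hc.2.le,
    hm (left_mem_Icc.2 (by linarith)) (Ioo_subset_Icc_self hc) hc.1.le⟩

lemma hasDerivAt_rpow_one_sub {α x : ℝ} (hx : 0 < x) :
    HasDerivAt (fun y : ℝ => y ^ (1 - α)) ((1 - α) * x ^ (-α)) x := by
  have h := Real.hasDerivAt_rpow_const (x := x) (p := 1 - α) (Or.inl hx.ne')
  rwa [show (1 - α - 1 : ℝ) = -α by ring] at h

lemma hasDerivAt_rpow_two_sub_div {α x : ℝ} (hα : α < 1) (hx : 0 < x) :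
    HasDerivAt (fun y : ℝ => y ^ (2 - α) / (2 - α)) (x ^ (1 - α)) x := by
  have h := (Real.hasDerivAt_rpow_const (x := x) (p := 2 - α) (Or.inl hx.ne')).div_const (2 - α)
  rwa [show (2 - α - 1 : ℝ) = 1 - α by ring,
    mul_div_cancel_left₀ _ (by linarith : (2 - α : ℝ) ≠ 0)] at h

lemma convexOn_rpow_neg {α : ℝ} (hα : 0 ≤ α) :
    ConvexOn ℝ (Ioi 0) (fun y : ℝ => y ^ (-α)) := by
  refine convexOn_of_hasDerivWithinAt2_nonneg (convex_Ioi 0)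
    (f' := fun y => -α * y ^ (-α - 1)) (f'' := fun y => -α * ((-α - 1) * y ^ (-α - 1 - 1)))
    ?_ ?_ ?_ ?_
  · intro x hx
    exact (Real.continuousAt_rpow_const x _ (Or.inl (ne_of_gt hx))).continuousWithinAt
  all_goals
    intro x hx
    rw [interior_Ioi] at hx
    replace hx : 0 < x := hx
  · exact (Real.hasDerivAt_rpow_const (Or.inl hx.ne')).hasDerivWithinAt
  · exact ((Real.hasDerivAt_rpow_const (Or.inl hx.ne')).const_mul _).hasDerivWithinAt
  · have := Real.rpow_nonneg hx.le (-α - 1 - 1)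
    have : -α * ((-α - 1) * x ^ (-α - 1 - 1)) = α * (α + 1) * x ^ (-α - 1 - 1) := by ring
    rw [this]
    positivity

/-- The increment of `y ↦ y ^ (1 - α)` over `[x, x + 1]`. -/
noncomputable def powIncr (α x : ℝ) : ℝ := (x + 1) ^ (1 - α) - x ^ (1 - α)

/-- The error of the trapezoidal rule for `y ↦ y ^ (1 - α)` on `[x, x + 1]`. -/
noncomputable def trapDefect (α x : ℝ) : ℝ :=
  ((x + 1) ^ (2 - α) / (2 - α) - x ^ (2 - α) / (2 - α)) - ((x + 1) ^ (1 - α) + x ^ (1 - α)) / 2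

section
variable {α x : ℝ}

lemma antitoneOn_rpow_neg (hα : 0 ≤ α) : AntitoneOn (fun y : ℝ => y ^ (-α)) (Ioi 0) :=
  fun _ hy _ _ hyz => Real.rpow_le_rpow_of_nonpos hy hyz (by linarith)

lemma powIncr_mem_Icc (hα : α ∈ Ioo (0 : ℝ) 1) (hx : 0 < x) :
    powIncr α x ∈ Icc ((1 - α) * (x + 1) ^ (-α)) ((1 - α) * x ^ (-α)) := by
  refine sub_mem_Icc_of_antitoneOn_deriv (f := fun y : ℝ => y ^ (1 - α))
    (f' := fun y : ℝ => (1 - α) * y ^ (-α))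
    (fun y hy => hasDerivAt_rpow_one_sub (hx.trans_le hy.1)) ?_
  intro y hy z hz hyz
  exact mul_le_mul_of_nonneg_left (antitoneOn_rpow_neg hα.1.le (hx.trans_le hy.1)
    (hx.trans_le hz.1) hyz) (by linarith [hα.2])

lemma powIncr_le_average (hα : α ∈ Ioo (0 : ℝ) 1) (hx : 0 < x) :
    powIncr α x ≤ (1 - α) * (x ^ (-α) + (x + 1) ^ (-α)) / 2 := by
  have h := sub_le_average_of_convexOn_deriv (a := x) (f := fun y : ℝ => y ^ (1 - α))
    (f' := fun y : ℝ => (1 - α) * y ^ (-α))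
    (fun y hy => hasDerivAt_rpow_one_sub (hx.trans_le hy.1))
    (((convexOn_rpow_neg hα.1.le).subset (fun y hy => hx.trans_le hy.1)
      (convex_Icc _ _)).smul (by linarith [hα.2]))
  rw [powIncr]
  linarith

lemma powIncr_nonneg (hα : α ∈ Ioo (0 : ℝ) 1) (hx : 0 < x) : 0 ≤ powIncr α x :=
  (mul_nonneg (by linarith [hα.2]) (Real.rpow_nonneg (by linarith) _)).trans
    (powIncr_mem_Icc hα hx).1

lemma trapDefect_nonneg (hα : α ∈ Ioo (0 : ℝ) 1) (hx : 0 < x) : 0 ≤ trapDefect α x := by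
  have h := sub_le_average_of_convexOn_deriv (a := x)
    (f := fun y : ℝ => -(y ^ (2 - α) / (2 - α))) (f' := fun y : ℝ => -(y ^ (1 - α)))
    (fun y hy => (hasDerivAt_rpow_two_sub_div hα.2 (hx.trans_le hy.1)).neg)
    (((Real.concaveOn_rpow (p := 1 - α) (by linarith [hα.2]) (by linarith [hα.1])).subset
      (fun y hy => (hx.le.trans hy.1)) (convex_Icc _ _)).neg)
  rw [trapDefect]
  linarith

lemma hasDerivAt_powIncr (hx : 0 < x) :
    HasDerivAt (powIncr α) ((1 - α) * (x + 1) ^ (-α) - (1 - α) * x ^ (-α)) x :=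
  ((hasDerivAt_rpow_one_sub (by linarith : 0 < x + 1)).comp_add_const x 1).sub
    (hasDerivAt_rpow_one_sub hx)

lemma hasDerivAt_trapDefect (hα : α < 1) (hx : 0 < x) :
    HasDerivAt (trapDefect α)
      (powIncr α x - ((1 - α) * (x + 1) ^ (-α) + (1 - α) * x ^ (-α)) / 2) x :=
  have hx1 : 0 < x + 1 := by linarith
  (((hasDerivAt_rpow_two_sub_div hα hx1).comp_add_const x 1).sub
      (hasDerivAt_rpow_two_sub_div hα hx)).sub
    ((((hasDerivAt_rpow_one_sub hx1).comp_add_const x 1).add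
      (hasDerivAt_rpow_one_sub hx)).div_const 2)

lemma antitoneOn_trapDefect (hα : α ∈ Ioo (0 : ℝ) 1) : AntitoneOn (trapDefect α) (Ioi 0) := by
  refine antitoneOn_of_hasDerivWithinAt_nonpos (convex_Ioi 0)
    (fun x hx => (hasDerivAt_trapDefect hα.2 hx).continuousAt.continuousWithinAt)
    (fun x hx => (hasDerivAt_trapDefect hα.2 (interior_subset hx)).hasDerivWithinAt) ?_
  intro x hx
  linarith [powIncr_le_average hα (interior_subset hx)]

lemma antitoneOn_powIncr_sub_trapDefect (hα : α ∈ Ioo (0 : ℝ) 1) :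
    AntitoneOn (fun x => powIncr α x - trapDefect α x) (Ioi 0) := by
  refine antitoneOn_of_hasDerivWithinAt_nonpos (convex_Ioi 0)
    (fun x hx => ((hasDerivAt_powIncr hx).sub
      (hasDerivAt_trapDefect hα.2 hx)).continuousAt.continuousWithinAt)
    (fun x hx => ((hasDerivAt_powIncr (interior_subset hx)).sub
      (hasDerivAt_trapDefect hα.2 (interior_subset hx))).hasDerivWithinAt) ?_
  intro x hx
  replace hx : 0 < x := interior_subset hx
  have h := (powIncr_mem_Icc hα hx).1
  have h1 : (1 - α) * (x + 1) ^ (-α) ≤ (1 - α) * x ^ (-α) :=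
    mul_le_mul_of_nonneg_left (antitoneOn_rpow_neg hα.1.le hx (by simp; linarith)
      (by linarith)) (by linarith [hα.2])
  linarith

lemma trapDefect_le_powIncr (hα : α ∈ Ioo (0 : ℝ) 1) (hx : 0 < x) :
    trapDefect α x ≤ powIncr α x := by
  have h := sub_mem_Icc_of_antitoneOn_deriv (a := x)
    (f := fun y : ℝ => -(y ^ (2 - α) / (2 - α))) (f' := fun y : ℝ => -(y ^ (1 - α)))
    (fun y hy => (hasDerivAt_rpow_two_sub_div hα.2 (hx.trans_le hy.1)).neg)
    (fun y hy z _ hyz => neg_le_neg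
      (Real.rpow_le_rpow (hx.le.trans hy.1) hyz (by linarith [hα.2])))
  have h0 := powIncr_nonneg hα hx
  rw [powIncr] at *
  rw [trapDefect]
  linarith [h.1]

end

lemma aCoef_succ (α σ : ℝ) (l : ℕ) : aCoef α σ (l + 1) = powIncr α (l + σ) := by
  rw [aCoef, if_neg l.succ_ne_zero, powIncr]
  push_cast
  congr 2 <;> ring

lemma bCoef_succ (α σ : ℝ) (l : ℕ) : bCoef α σ (l + 1) = trapDefect α (l + σ) := by
  rw [bCoef, trapDefect, sub_div]
  push_cast
  rw [show (l : ℝ) + 1 - 1 + σ = l + σ by ring, show (l : ℝ) + 1 + σ = l + σ + 1 by ring]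

lemma mul_aCoef_one_le {α σ : ℝ} (hα : α ∈ Ioo (0 : ℝ) 1) (hσ : σ = 1 - α / 2) :
    σ * aCoef α σ 1 ≤ (2 * σ - 1) * aCoef α σ 0 := by
  have hσ0 : 0 < σ := by linarith [hα.2]
  have h := (powIncr_mem_Icc hα hσ0).2
  have h1 : aCoef α σ 1 = powIncr α σ := by simpa using aCoef_succ α σ 0
  have h0 : aCoef α σ 0 = σ * σ ^ (-α) := by
    rw [aCoef, if_pos rfl, sub_eq_add_neg, Real.rpow_add hσ0, Real.rpow_one]
  rw [h1, h0, show 2 * σ - 1 = 1 - α by linarith]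
  nlinarith

section
variable {α σ τ : ℝ} {lam : ℝ → ℝ} {j : ℕ}

lemma cCoef_succ_le (hα : α ∈ Ioo (0 : ℝ) 1) (hσ : σ = 1 - α / 2) (hτ : 0 < τ)
    (hpos : ∀ t ∈ Icc (0 : ℝ) ((j + σ) * τ), 0 < lam t)
    (hmono : AntitoneOn lam (Icc (0 : ℝ) ((j + σ) * τ))) {i : ℕ} (hi : i + 2 ≤ j) :
    cCoef α σ τ lam j (i + 2) ≤ cCoef α σ τ lam j (i + 1) := by
  have hσ0 : 0 < σ := by linarith [hα.2]
  have hx : 0 < (i : ℝ) + σ := by positivity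
  have hj : (i : ℝ) + 2 ≤ j := by exact_mod_cast hi
  have hmem : ∀ r : ℝ, 0 ≤ r → r ≤ j + σ → r * τ ∈ Icc (0 : ℝ) ((j + σ) * τ) :=
    fun r h0 h1 => ⟨by positivity, by gcongr⟩
  have m0 := hmem (i + σ + 1 / 2) (by linarith) (by linarith)
  have m1 := hmem (i + σ + 1) (by linarith) (by linarith)
  have m2 := hmem (i + σ + 3 / 2) (by linarith) (by linarith)
  have m3 := hmem (i + σ + 2) (by linarith) (by linarith)
  have l01 := hmono m0 m1 (by gcongr; norm_num)
  have l12 := hmono m1 m2 (by gcongr; norm_num)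
  have p1 := hpos _ m1
  have p3 := hpos _ m3
  have ha0 := powIncr_nonneg hα hx
  have ha1 := powIncr_nonneg hα (by linarith : 0 < (i : ℝ) + σ + 1)
  have hab := antitoneOn_powIncr_sub_trapDefect hα hx (by simp; linarith : (i : ℝ) + σ + 1 ∈ _)
    (by linarith)
  have hb2 := trapDefect_nonneg hα (by linarith : 0 < (i : ℝ) + σ + 1)
  have hb23 := antitoneOn_trapDefect hα (by simp; linarith : (i : ℝ) + σ + 1 ∈ _)
    (by simp; linarith : (i : ℝ) + σ + 2 ∈ _) (by linarith)
  simp only at hab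
  have e1 : cCoef α σ τ lam j (i + 1) =
      lam ((i + σ + 1 / 2) * τ) * powIncr α (i + σ) +
        lam ((i + σ + 1) * τ) * trapDefect α (i + σ + 1) -
          lam ((i + σ + 1) * τ) * trapDefect α (i + σ) := by
    rw [cCoef, if_neg (by omega), if_neg (by omega), if_neg (by omega), aCoef_succ, bCoef_succ,
      bCoef_succ]
    push_cast
    ring_nf
  have e2 : cCoef α σ τ lam j (i + 2) =
      lam ((i + σ + 3 / 2) * τ) * powIncr α (i + σ + 1) -
        lam ((i + σ + 2) * τ) * (trapDefect α (i + σ + 1) -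
          if i + 2 = j then 0 else trapDefect α (i + σ + 2)) := by
    rw [cCoef, if_neg (by omega), if_neg (by omega)]
    split_ifs with h
    · subst h
      rw [aCoef_succ, bCoef_succ]
      push_cast
      ring_nf
    · rw [aCoef_succ, bCoef_succ, bCoef_succ]
      push_cast
      ring_nf
  have hb : 0 ≤ lam ((i + σ + 2) * τ) * (trapDefect α (i + σ + 1) -
      if i + 2 = j then 0 else trapDefect α (i + σ + 2)) := by
    apply mul_nonneg p3.le
    split_ifs <;> linarith
  have t1 := mul_le_mul_of_nonneg_right l01 ha0
  have t2 := mul_le_mul_of_nonneg_right l12 ha1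
  have t3 := mul_le_mul_of_nonneg_left hab p1.le
  rw [e1, e2]
  linarith

lemma cCoef_last_nonneg (hα : α ∈ Ioo (0 : ℝ) 1) (hσ : σ = 1 - α / 2) (hτ : 0 < τ)
    (hpos : ∀ t ∈ Icc (0 : ℝ) (((j + 1 : ℕ) + σ) * τ), 0 < lam t)
    (hmono : AntitoneOn lam (Icc (0 : ℝ) (((j + 1 : ℕ) + σ) * τ))) :
    0 ≤ cCoef α σ τ lam (j + 1) (j + 1) := by
  have hσ0 : 0 < σ := by linarith [hα.2]
  have hx : 0 < (j : ℝ) + σ := by positivity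
  have m1 : ((j + 1 : ℕ) + σ) * τ ∈ Icc (0 : ℝ) (((j + 1 : ℕ) + σ) * τ) :=
    ⟨by positivity, le_rfl⟩
  have m0 : ((j + 1 : ℕ) + σ - 1 / 2) * τ ∈ Icc (0 : ℝ) (((j + 1 : ℕ) + σ) * τ) :=
    ⟨mul_nonneg (by push_cast; linarith) hτ.le, by gcongr; linarith⟩
  have l01 := hmono m0 m1 m0.2
  rw [cCoef, if_neg j.succ_ne_zero, if_neg j.succ_ne_zero, if_pos rfl, aCoef_succ, bCoef_succ,
    sub_nonneg]
  exact mul_le_mul l01 (trapDefect_le_powIncr hα hx) (trapDefect_nonneg hα hx) (hpos _ m0).le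

lemma mul_cCoef_one_le (hα : α ∈ Ioo (0 : ℝ) 1) (hσ : σ = 1 - α / 2) (hτ : 0 < τ)
    (hpos : ∀ t ∈ Icc (0 : ℝ) (((j + 1 : ℕ) + σ) * τ), 0 < lam t)
    (hmono : AntitoneOn lam (Icc (0 : ℝ) (((j + 1 : ℕ) + σ) * τ))) :
    σ * cCoef α σ τ lam (j + 1) 1 ≤ (2 * σ - 1) * cCoef α σ τ lam (j + 1) 0 := by
  have hσ0 : 0 < σ := by linarith [hα.2]
  have hj : (0 : ℝ) ≤ j := by positivity
  have hmem : ∀ r : ℝ, 0 ≤ r → r ≤ j + 1 + σ → r * τ ∈ Icc (0 : ℝ) (((j + 1 : ℕ) + σ) * τ) :=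
    fun r h0 h1 => ⟨by positivity, by push_cast; gcongr⟩
  have m0 := hmem (σ - 1 / 2) (by linarith [hα.2]) (by linarith)
  have m1 := hmem σ (by linarith) (by linarith)
  have m2 := hmem (σ + 1 / 2) (by linarith) (by linarith)
  have m3 := hmem (σ + 1) (by linarith) (by linarith)
  have l02 := hmono m0 m2 (by gcongr; linarith)
  have hb0 := trapDefect_nonneg hα hσ0
  have hb01 := antitoneOn_trapDefect hα hσ0 (by simp; linarith : σ + 1 ∈ _) (by linarith)
  have ha1 := powIncr_nonneg hα hσ0
  have ha : σ * powIncr α σ ≤ (2 * σ - 1) * aCoef α σ 0 := by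
    have h := mul_aCoef_one_le hα hσ
    have h1 := aCoef_succ α σ 0
    simp only [zero_add, Nat.cast_zero] at h1
    rwa [h1] at h
  have e0 : cCoef α σ τ lam (j + 1) 0 =
      lam ((σ - 1 / 2) * τ) * aCoef α σ 0 + lam (σ * τ) * trapDefect α σ := by
    rw [cCoef, if_neg j.succ_ne_zero, if_pos rfl, bCoef_succ α σ 0]
    simp
  have e1 : cCoef α σ τ lam (j + 1) 1 = lam ((σ + 1 / 2) * τ) * powIncr α σ -
      lam ((σ + 1) * τ) * (trapDefect α σ - if j = 0 then 0 else trapDefect α (σ + 1)) := by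
    rw [cCoef, if_neg j.succ_ne_zero, if_neg one_ne_zero, aCoef_succ α σ 0, bCoef_succ α σ 1,
      bCoef_succ α σ 0]
    rcases eq_or_ne j 0 with rfl | h
    · simp only [zero_add, aCoef_succ α σ 0, bCoef_succ α σ 0, if_true, Nat.cast_zero, Nat.cast_one]
      ring_nf
    · rw [if_neg (by omega), if_neg h]
      push_cast
      ring_nf
  have hb : 0 ≤ lam ((σ + 1) * τ) *
      (trapDefect α σ - if j = 0 then 0 else trapDefect α (σ + 1)) := by
    apply mul_nonneg (hpos _ m3).le
    split_ifs <;> linarith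
  have hc1 : cCoef α σ τ lam (j + 1) 1 ≤ lam ((σ - 1 / 2) * τ) * powIncr α σ := by
    have := mul_le_mul_of_nonneg_right l02 ha1
    linarith
  have hc0 : lam ((σ - 1 / 2) * τ) * aCoef α σ 0 ≤ cCoef α σ τ lam (j + 1) 0 := by
    have := mul_nonneg (hpos _ m1).le hb0
    linarith
  calc σ * cCoef α σ τ lam (j + 1) 1
      ≤ σ * (lam ((σ - 1 / 2) * τ) * powIncr α σ) := by gcongr
    _ = lam ((σ - 1 / 2) * τ) * (σ * powIncr α σ) := by ring
    _ ≤ lam ((σ - 1 / 2) * τ) * ((2 * σ - 1) * aCoef α σ 0) :=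
        mul_le_mul_of_nonneg_left ha (hpos _ m0).le
    _ = (2 * σ - 1) * (lam ((σ - 1 / 2) * τ) * aCoef α σ 0) := by ring
    _ ≤ (2 * σ - 1) * cCoef α σ τ lam (j + 1) 0 :=
        mul_le_mul_of_nonneg_left hc0 (by linarith [hα.2])

end

lemma sum_mul_sub_le_of_monotone {k y : ℕ → ℝ} (hy : ∀ s, 0 ≤ y s) (n : ℕ) (h0 : 0 ≤ k 0)
    (hk : ∀ s < n, k s ≤ k (s + 1)) :
    ∑ s ∈ Finset.range (n + 1), k s * (y (s + 1) - y s) ≤ k n * y (n + 1) := by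
  induction n with
  | zero =>
    have := mul_nonneg h0 (hy 0)
    simp only [zero_add, Finset.sum_range_one]
    linarith
  | succ n ih =>
    rw [Finset.sum_range_succ]
    have h1 := ih fun s hs => hk s (by omega)
    have h2 := mul_le_mul_of_nonneg_right (hk n (by omega)) (hy (n + 1))
    linarith

/-- Alikhanov's inequality for a discrete convolution kernel `c`, in expanded form. -/
lemma sum_kernel_mul_sq_sub_nonpos {σ : ℝ} (hσ : σ ∈ Icc (1 / 2 : ℝ) 1) (c : ℕ → ℝ) (j : ℕ)
    (hlast : 0 ≤ c j) (hc : ∀ i, i + 2 ≤ j → c (i + 2) ≤ c (i + 1))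
    (hone : 1 ≤ j → σ * c 1 ≤ (2 * σ - 1) * c 0) (v : ℕ → ℝ) :
    ∑ s ∈ Finset.range (j + 1), c (j - s) *
      ((v (s + 1) - (σ * v (j + 1) + (1 - σ) * v j)) ^ 2 -
        (v s - (σ * v (j + 1) + (1 - σ) * v j)) ^ 2) ≤ 0 := by
  obtain ⟨hσ1, hσ2⟩ := hσ
  set w := σ * v (j + 1) + (1 - σ) * v j with hw
  have e1 : (v (j + 1) - w) ^ 2 = (1 - σ) ^ 2 * (v (j + 1) - v j) ^ 2 := by rw [hw]; ring
  have e0 : (v j - w) ^ 2 = σ ^ 2 * (v (j + 1) - v j) ^ 2 := by rw [hw]; ring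
  have hd := sq_nonneg (v (j + 1) - v j)
  rw [Finset.sum_range_succ, Nat.sub_self, e1, e0]
  cases j with
  | zero =>
    have := mul_nonneg (mul_nonneg hlast (by linarith : 0 ≤ 2 * σ - 1)) hd
    simp only [Finset.range_zero, Finset.sum_empty]
    linarith
  | succ m =>
    have hmono : ∀ s < m, c (m + 1 - s) ≤ c (m + 1 - (s + 1)) := by
      intro s hs
      have h := hc (m - 1 - s) (by omega)
      rwa [show m - 1 - s + 2 = m + 1 - s by omega,
        show m - 1 - s + 1 = m + 1 - (s + 1) by omega] at h
    have hsum := sum_mul_sub_le_of_monotone (k := fun s => c (m + 1 - s))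
      (y := fun s => (v s - w) ^ 2) (fun s => sq_nonneg _) m hlast hmono
    simp only [show m + 1 - m = 1 by omega, e0] at hsum
    have hc1 : 0 ≤ c 1 := by
      have h : ∀ n ≤ m, 0 ≤ c (m + 1 - n) := by
        intro n
        induction n with
        | zero => exact fun _ => hlast
        | succ n ih => exact fun hn => (ih (by omega)).trans (hmono n (by omega))
      simpa [show m + 1 - m = 1 by omega] using h m le_rfl
    have h1 : σ ^ 2 * c 1 ≤ (2 * σ - 1) * c 0 := by
      refine le_trans ?_ (hone (by omega))
      have := mul_nonneg (mul_nonneg (by linarith : 0 ≤ σ) hc1) (by linarith : 0 ≤ 1 - σ)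
      linarith
    have := mul_le_mul_of_nonneg_right h1 hd
    linarith

/-- Corollary 2 of the paper:
if `α ∈ (0,1)`, `σ = 1 − α/2`, `τ > 0`, `j ≥ 0`, and `λ` is positive and nonincreasing
on `[0, (j+σ)τ]`, then for any reals `v 0, …, v (j+1)`:
`(σ v_{j+1} + (1−σ) v_j) · Δ_{0t_{j+σ}}^{α,λ} v ≥ (1/2) Δ_{0t_{j+σ}}^{α,λ}(v²)`. -/
theorem statement12 (α σ τ : ℝ) (hα : α ∈ Set.Ioo (0 : ℝ) 1) (hσ : σ = 1 - α / 2)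
    (hτ : 0 < τ) (j : ℕ) (lam : ℝ → ℝ)
    (hlam_pos : ∀ t ∈ Set.Icc (0 : ℝ) (((j : ℝ) + σ) * τ), 0 < lam t)
    (hlam_mono : AntitoneOn lam (Set.Icc (0 : ℝ) (((j : ℝ) + σ) * τ)))
    (v : ℕ → ℝ) :
    (σ * v (j + 1) + (1 - σ) * v j) *
        (τ ^ (1 - α) / Real.Gamma (2 - α) *
          ∑ s ∈ Finset.range (j + 1), cCoef α σ τ lam j (j - s) * ((v (s + 1) - v s) / τ)) ≥
      (1 / 2) *
        (τ ^ (1 - α) / Real.Gamma (2 - α) *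
          ∑ s ∈ Finset.range (j + 1),
            cCoef α σ τ lam j (j - s) * (((v (s + 1)) ^ 2 - (v s) ^ 2) / τ)) := by
  have hα0 := hα.1
  have hα1 := hα.2
  have hlast : 0 ≤ cCoef α σ τ lam j j := by
    cases j with
    | zero =>
      have hm : (σ - 1 / 2) * τ ∈ Icc (0 : ℝ) (((0 : ℕ) + σ) * τ) :=
        ⟨mul_nonneg (by linarith) hτ.le, by gcongr; push_cast; linarith⟩
      rw [cCoef, if_pos rfl, aCoef, if_pos rfl]
      exact mul_nonneg (hlam_pos _ hm).le (Real.rpow_nonneg (by linarith) _)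
    | succ m => exact cCoef_last_nonneg hα hσ hτ hlam_pos hlam_mono
  have hone : 1 ≤ j → σ * cCoef α σ τ lam j 1 ≤ (2 * σ - 1) * cCoef α σ τ lam j 0 := by
    intro hj
    obtain ⟨m, rfl⟩ := Nat.exists_eq_add_of_le' hj
    exact mul_cCoef_one_le hα hσ hτ hlam_pos hlam_mono
  have hsum := sum_kernel_mul_sq_sub_nonpos (σ := σ) ⟨by linarith, by linarith⟩
    (cCoef α σ τ lam j) j hlast (fun i hi => cCoef_succ_le hα hσ hτ hlam_pos hlam_mono hi) hone v
  set w := σ * v (j + 1) + (1 - σ) * v j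
  have hΓ : 0 < Real.Gamma (2 - α) := Real.Gamma_pos_of_pos (by linarith)
  have hK : 0 ≤ τ ^ (1 - α) / Real.Gamma (2 - α) := by positivity
  have key : (1 / 2) * ∑ s ∈ Finset.range (j + 1),
        cCoef α σ τ lam j (j - s) * ((v (s + 1) ^ 2 - v s ^ 2) / τ) -
      w * ∑ s ∈ Finset.range (j + 1), cCoef α σ τ lam j (j - s) * ((v (s + 1) - v s) / τ) =
      1 / (2 * τ) * ∑ s ∈ Finset.range (j + 1),
        cCoef α σ τ lam j (j - s) * ((v (s + 1) - w) ^ 2 - (v s - w) ^ 2) := by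
    rw [Finset.mul_sum, Finset.mul_sum, Finset.mul_sum, ← Finset.sum_sub_distrib]
    refine Finset.sum_congr rfl fun s _ => ?_
    field_simp
    ring
  have hle := mul_nonpos_of_nonneg_of_nonpos (by positivity : 0 ≤ 1 / (2 * τ)) hsum
  rw [← key] at hle
  have := mul_nonpos_of_nonneg_of_nonpos hK hle
  linarith
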